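/- Let N be a positive integer, α > 0, and λ₁, …, λ_N > 0. Let Y be a real-valued random variable on a probability space with Y ≥ 0 almost surely, whose Laplace transform satisfies E[e^{−sY}] = ∏_{n=1}^N (1 + λ_n s)^{−α} for every s > 0. Then the cumulative distribution function of Y is given, for every y ≥ 0, by P(Y ≤ y) = y^{Nα} / ( (∏_{n=1}^N λ_n)^{α} · Γ(1 + Nα) ) · Φ₂^(N)(α, …, α; 1 + Nα; −y/λ₁, …, −y/λ_N). -/

import Mathlib

open scoped BigOperators
open MeasureTheory
open scoped ProbabilityTheory

/-- The confluent Lauricella function `Φ₂^(N)`, defined by the multiple power series. -/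
noncomputable def lauricellaPhi2 (N : ℕ) (b : Fin N → ℝ) (c : ℝ) (x : Fin N → ℝ) : ℝ :=
  ∑' m : Fin N → ℕ,
    ((∏ n, (ascPochhammer ℝ (m n)).eval (b n)) / (ascPochhammer ℝ (∑ n, m n)).eval c) *
      ∏ n, x n ^ m n / (Nat.factorial (m n))


noncomputable def sepFun (y : ℝ) : ℝ := if 0 ≤ y then Real.exp (-y) else 2 - Real.exp y

lemma sepFun_continuous : Continuous sepFun := by
  unfold sepFun
  apply Continuous.if_le
  · fun_prop
  · fun_prop
  · fun_prop
  · fun_prop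
  · intro x hx
    subst hx
    norm_num

lemma sepFun_bound (y : ℝ) : |sepFun y| ≤ 2 := by
  unfold sepFun
  split_ifs with h
  · have h1 := Real.exp_pos (-y)
    have h2 : Real.exp (-y) ≤ 1 := Real.exp_le_one_iff.2 (by linarith)
    rw [abs_le]; constructor <;> linarith
  · have h1 := Real.exp_pos y
    have h2 : Real.exp y ≤ 1 := Real.exp_le_one_iff.2 (by linarith)
    rw [abs_le]; constructor <;> linarith

lemma sepFun_inj : Function.Injective sepFun := by
  intro x y h
  unfold sepFun at h
  split_ifs at h with h1 h2 h2
  · have := Real.exp_injective h; linarith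
  · have := Real.exp_le_one_iff.2 (show -x ≤ 0 by linarith)
    have := Real.exp_lt_one_iff.2 (show y < 0 by linarith)
    linarith
  · have := Real.exp_le_one_iff.2 (show -y ≤ 0 by linarith)
    have := Real.exp_lt_one_iff.2 (show x < 0 by linarith)
    linarith
  · exact Real.exp_injective (by linarith)

noncomputable def sepBCF : BoundedContinuousFunction ℝ ℝ :=
  BoundedContinuousFunction.ofNormedAddCommGroup sepFun sepFun_continuous 2 sepFun_bound

lemma sepBCF_aeval (p : Polynomial ℝ) (x : ℝ) :
    (Polynomial.aeval sepBCF p) x = p.eval (sepFun x) := by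
  induction p using Polynomial.induction_on' with
  | add p q hp hq => simp [hp, hq]
  | monomial n a =>
    simp [Polynomial.aeval_monomial, sepBCF]

lemma meas_eq_of_moments (P Q : Measure ℝ) [IsFiniteMeasure P] [IsFiniteMeasure Q]
    (h : ∀ k : ℕ, ∫ x, sepFun x ^ k ∂P = ∫ x, sepFun x ^ k ∂Q) : P = Q := by
  let A : StarSubalgebra ℝ (BoundedContinuousFunction ℝ ℝ) :=
    { Algebra.adjoin ℝ {sepBCF} with
      star_mem' := by
        intro a ha
        have : star a = a := by ext x; simp
        rw [this]; exact ha }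
  have hmem : ∀ g, g ∈ A ↔ g ∈ Algebra.adjoin ℝ {sepBCF} := fun g => Iff.rfl
  refine ext_of_forall_mem_subalgebra_integral_eq_of_pseudoEMetric_complete_countable (𝕜 := ℝ)
    (A := A) ?_ ?_
  · intro x y hxy
    refine ⟨sepFun, ⟨_, ⟨sepBCF, (hmem _).2 (Algebra.self_mem_adjoin_singleton _ _), rfl⟩, rfl⟩, ?_⟩
    exact fun h => hxy (sepFun_inj h)
  · intro g hg
    rw [hmem, Algebra.adjoin_singleton_eq_range_aeval] at hg
    obtain ⟨p, rfl⟩ := hg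
    have hi : ∀ (ρ : Measure ℝ) [IsFiniteMeasure ρ] (k : ℕ),
        Integrable (fun x => sepFun x ^ k) ρ := by
      intro ρ _ k
      refine Integrable.of_bound (sepFun_continuous.pow k).aestronglyMeasurable (2 ^ k) ?_
      filter_upwards with x
      rw [norm_pow]
      exact pow_le_pow_left₀ (norm_nonneg _) (sepFun_bound x) k
    have key : ∀ (ρ : Measure ℝ) [IsFiniteMeasure ρ],
        ∫ x, (Polynomial.aeval sepBCF p) x ∂ρ
          = ∑ k ∈ p.support, p.coeff k * ∫ x, sepFun x ^ k ∂ρ := by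
      intro ρ _
      simp_rw [sepBCF_aeval, Polynomial.eval_eq_sum, Polynomial.sum]
      rw [integral_finsetSum]
      · simp_rw [integral_const_mul]
      · intro k _
        exact (hi ρ k).const_mul _
    have k1 := key P
    have k2 := key Q
    simp only [h] at k1
    exact k1.trans k2.symm

lemma laplace_unique (h : ℝ → ℝ) (hintg : IntegrableOn h (Set.Ioi 0))
    (h0 : ∀ k : ℕ, ∫ y in Set.Ioi 0, Real.exp (-(k : ℝ) * y) * h y = 0) :
    h =ᵐ[volume.restrict (Set.Ioi 0)] 0 := by
  set ν : Measure ℝ := volume.restrict (Set.Ioi 0) with hν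
  have hintg' : Integrable h ν := hintg
  have e1 : ∫⁻ a, ENNReal.ofReal (h a) ∂ν ≠ ⊤ := hintg'.lintegral_lt_top.ne
  have e2 : ∫⁻ a, ENNReal.ofReal (-h a) ∂ν ≠ ⊤ := hintg'.neg.lintegral_lt_top.ne
  have hm := hintg'.aestronglyMeasurable.aemeasurable
  have hmn : AEMeasurable (fun a => -h a) ν := hm.neg
  have f1 : IsFiniteMeasure (ν.withDensity (fun a => ENNReal.ofReal (h a))) :=
    isFiniteMeasure_withDensity e1
  have f2 : IsFiniteMeasure (ν.withDensity (fun a => ENNReal.ofReal (-h a))) :=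
    isFiniteMeasure_withDensity e2
  have heq : ν.withDensity (fun a => ENNReal.ofReal (h a))
      = ν.withDensity (fun a => ENNReal.ofReal (-h a)) := by
    apply meas_eq_of_moments
    intro k
    rw [integral_withDensity_eq_integral_toReal_smul₀ hm.ennreal_ofReal (by simp),
      integral_withDensity_eq_integral_toReal_smul₀ hmn.ennreal_ofReal (by simp)]
    rw [← sub_eq_zero, ← integral_sub, ← h0 k]
    · refine setIntegral_congr_fun measurableSet_Ioi ?_
      intro y hy
      have : sepFun y ^ k = Real.exp (-(k : ℝ) * y) := by
        rw [sepFun, if_pos (le_of_lt hy), ← Real.exp_nat_mul]; ring_nf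
      simp only [this, smul_eq_mul, ENNReal.toReal_ofReal']
      rw [← sub_mul, mul_comm]
      congr 1
      exact max_zero_sub_max_neg_zero_eq_self (h y)
    all_goals
      simp only [ENNReal.toReal_ofReal', smul_eq_mul]
      refine Integrable.mul_bdd (c := 2 ^ k) ?_ (sepFun_continuous.pow k).aestronglyMeasurable ?_
      · first | exact hintg'.pos_part | exact hintg'.neg_part
      · filter_upwards with x
        rw [norm_pow]
        exact pow_le_pow_left₀ (norm_nonneg _) (sepFun_bound x) k
  rw [withDensity_eq_iff hm.ennreal_ofReal hmn.ennreal_ofReal e1] at heq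
  filter_upwards [heq] with y hy
  simp only [Pi.zero_apply]
  rcases le_total 0 (h y) with hp | hp
  · have : ENNReal.ofReal (-h y) = 0 := ENNReal.ofReal_of_nonpos (by linarith)
    rw [this, ENNReal.ofReal_eq_zero] at hy
    linarith
  · have : ENNReal.ofReal (h y) = 0 := ENNReal.ofReal_of_nonpos (by linarith)
    rw [this] at hy
    have := ENNReal.ofReal_eq_zero.1 hy.symm
    linarith

lemma prod_hasSum : ∀ (N : ℕ) (f : Fin N → ℕ → ℝ) (_ : ∀ n, Summable fun k => ‖f n k‖),
    Summable (fun m : Fin N → ℕ => ‖∏ n, f n (m n)‖) ∧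
      HasSum (fun m : Fin N → ℕ => ∏ n, f n (m n)) (∏ n, ∑' k, f n k)
  | 0, f, hf => by
    refine ⟨Summable.of_finite, ?_⟩
    simp
  | N + 1, f, hf => by
    obtain ⟨i1, i2⟩ := prod_hasSum N (fun n => f n.succ) (fun n => hf n.succ)
    have a1 := summable_mul_of_summable_norm (hf 0) i1
    have a2 := tsum_mul_tsum_of_summable_norm (hf 0) i1
    have a3 := (hf 0).mul_norm i1
    have hs : HasSum (fun x : ℕ × (Fin N → ℕ) => f 0 x.1 * ∏ n, f (Fin.succ n) (x.2 n))
      (∏ n, ∑' k, f n k) := by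
      rw [Fin.prod_univ_succ, ← i2.tsum_eq, a2]
      exact a1.hasSum
    constructor
    · rw [← (Fin.consEquiv (fun _ => ℕ)).summable_iff]
      convert a3 using 2 with x
      simp [Fin.consEquiv, Fin.prod_univ_succ]
    · rw [← (Fin.consEquiv (fun _ => ℕ)).hasSum_iff]
      convert hs using 2 with x
      simp [Fin.consEquiv, Fin.prod_univ_succ]

lemma binom_hasSum (α x : ℝ) (hx : |x| < 1) :
    Summable (fun k : ℕ => ‖(ascPochhammer ℝ k).eval α / k.factorial * (-x) ^ k‖) ∧
    ∑' k : ℕ, (ascPochhammer ℝ k).eval α / k.factorial * (-x) ^ k = (1 + x) ^ (-α) := by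
  have hb := Real.one_div_one_sub_rpow_hasFPowerSeriesOnBall_zero α
  have hmem : -x ∈ Metric.eball (0 : ℝ) 1 := by
    rw [← ENNReal.ofReal_one, Metric.eball_ofReal]; simpa using hx
  have h1 := hb.hasSum hmem
  have h2 := FormalMultilinearSeries.summable_norm_apply _ (Metric.eball_subset_eball hb.r_le hmem)
  have hc : ∀ k : ℕ, Ring.choose (α + k - 1) k = (ascPochhammer ℝ k).eval α / k.factorial := by
    intro k
    have := Ring.factorial_nsmul_multichoose_eq_ascPochhammer α k
    rw [Ring.choose, show α + k - 1 - k + 1 = α by ring]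
    rw [Polynomial.ascPochhammer_smeval_eq_eval, nsmul_eq_mul] at this
    rw [← this]; field_simp
  simp only [FormalMultilinearSeries.ofScalars_apply_eq, hc, smul_eq_mul] at h1 h2
  refine ⟨h2, ?_⟩
  rw [h1.tsum_eq, Real.rpow_neg (by rw [abs_lt] at hx; linarith)]
  simp

lemma lap_pow (p s : ℝ) (hp : 0 ≤ p) (hs : 0 < s) :
    IntegrableOn (fun y : ℝ => Real.exp (-s * y) * (y ^ p / Real.Gamma (p + 1))) (Set.Ioi 0) ∧
    ∫ y in Set.Ioi 0, Real.exp (-s * y) * (y ^ p / Real.Gamma (p + 1)) = s ^ (-(p + 1)) := by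
  have hG : Real.Gamma (p + 1) ≠ 0 := (Real.Gamma_pos_of_pos (by linarith)).ne'
  have h1 := integrableOn_rpow_mul_exp_neg_mul_rpow (p := 1) (s := p) (b := s) (by linarith)
    one_pos hs
  have h2 := Real.integral_rpow_mul_exp_neg_mul_Ioi (a := p + 1) (r := s) (by linarith) hs
  have e : (fun y : ℝ => Real.exp (-s * y) * (y ^ p / Real.Gamma (p + 1)))
      = fun y => (Real.Gamma (p + 1))⁻¹ * (y ^ p * Real.exp (-s * y)) := by
    ext y; ring
  simp only [Real.rpow_one] at h1
  rw [e]
  refine ⟨h1.const_mul _, ?_⟩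
  rw [integral_const_mul]
  simp only [add_sub_cancel_right, ← neg_mul] at h2
  rw [h2, Real.rpow_neg hs.le, one_div, Real.inv_rpow hs.le]
  field_simp

lemma pow_bound (p s R : ℝ) (hp : 0 ≤ p) (hs : 0 < s) (hR : 0 ≤ R) :
    R ^ p / Real.Gamma (p + 1) ≤ Real.exp (s * (R + 1)) * s ^ (-(p + 1)) := by
  obtain ⟨h1, h2⟩ := lap_pow p s hp hs
  have hG : 0 < Real.Gamma (p + 1) := Real.Gamma_pos_of_pos (by linarith)
  rw [← h2]
  have hsub : Set.Ioc R (R + 1) ⊆ Set.Ioi 0 := fun x hx => lt_of_le_of_lt hR hx.1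
  have h3 : ∫ y in Set.Ioc R (R + 1), Real.exp (-s * y) * (y ^ p / Real.Gamma (p + 1)) ≤
      ∫ y in Set.Ioi 0, Real.exp (-s * y) * (y ^ p / Real.Gamma (p + 1)) := by
    refine setIntegral_mono_set h1 ?_ (Filter.Eventually.of_forall hsub)
    filter_upwards [ae_restrict_mem measurableSet_Ioi] with y hy
    have : (0 : ℝ) ≤ y := le_of_lt hy
    simp only [Pi.zero_apply]
    positivity
  have h4 : ∫ y in Set.Ioc R (R + 1), Real.exp (-(s * (R + 1))) * (R ^ p / Real.Gamma (p + 1)) ≤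
      ∫ y in Set.Ioc R (R + 1), Real.exp (-s * y) * (y ^ p / Real.Gamma (p + 1)) := by
    refine setIntegral_mono_on (integrableOn_const (by simp)) (h1.mono_set hsub) measurableSet_Ioc ?_
    intro y hy
    have hy0 : 0 ≤ y := hR.trans hy.1.le
    have a1 : Real.exp (-(s * (R + 1))) ≤ Real.exp (-s * y) := by
      apply Real.exp_le_exp.2
      nlinarith [hy.2]
    have a2 : R ^ p ≤ y ^ p := Real.rpow_le_rpow hR hy.1.le hp
    gcongr
  have h5 := h4.trans h3
  simp only [integral_const, smul_eq_mul] at h5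
  simp at h5
  rw [Real.exp_neg] at h5
  have hE := Real.exp_pos (s * (R + 1))
  rw [inv_mul_le_iff₀ hE] at h5
  simpa using h5

lemma series_lap {ι : Type*} [Countable ι] (c p : ι → ℝ) (hp : ∀ i, 0 ≤ p i) (s : ℝ) (hs : 0 < s)
    (hc : Summable fun i => ‖c i * s ^ (-(p i + 1))‖) :
    ∫ y in Set.Ioi 0, Real.exp (-s * y) * ∑' i, c i * (y ^ p i / Real.Gamma (p i + 1))
      = ∑' i, c i * s ^ (-(p i + 1)) := by
  have hI : ∀ i, IntegrableOn
      (fun y : ℝ => c i * (Real.exp (-s * y) * (y ^ p i / Real.Gamma (p i + 1)))) (Set.Ioi 0) :=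
    fun i => (lap_pow (p i) s (hp i) hs).1.const_mul _
  have hV : ∀ i, ∫ y in Set.Ioi 0, c i * (Real.exp (-s * y) * (y ^ p i / Real.Gamma (p i + 1)))
      = c i * s ^ (-(p i + 1)) := by
    intro i
    rw [integral_const_mul, (lap_pow (p i) s (hp i) hs).2]
  have hVn : ∀ i, ∫ y in Set.Ioi 0, ‖c i * (Real.exp (-s * y) * (y ^ p i / Real.Gamma (p i + 1)))‖
      = ‖c i * s ^ (-(p i + 1))‖ := by
    intro i
    rw [norm_mul, ← (lap_pow (p i) s (hp i) hs).2, Real.norm_of_nonneg (integral_nonneg_of_ae ?_),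
      ← integral_const_mul]
    · refine setIntegral_congr_fun measurableSet_Ioi ?_
      intro y hy
      have : (0 : ℝ) ≤ y := le_of_lt hy
      have hG : 0 < Real.Gamma (p i + 1) := Real.Gamma_pos_of_pos (by linarith [hp i])
      have h0 : 0 ≤ Real.exp (-s * y) * (y ^ p i / Real.Gamma (p i + 1)) := by positivity
      simp only [norm_mul (c i), Real.norm_of_nonneg h0]
    · filter_upwards [ae_restrict_mem measurableSet_Ioi] with y hy
      have : (0 : ℝ) ≤ y := le_of_lt hy
      have hG : 0 < Real.Gamma (p i + 1) := Real.Gamma_pos_of_pos (by linarith [hp i])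
      simp only [Pi.zero_apply]
      positivity
  have := integral_tsum_of_summable_integral_norm hI (by simpa only [hVn] using hc)
  simp only [hV] at this
  rw [this]
  congr 1
  ext y
  rw [← tsum_mul_left]
  congr 1
  ext i
  ring

lemma series_cont {ι : Type*} [Countable ι] (c p : ι → ℝ) (hp : ∀ i, 0 ≤ p i) (s : ℝ) (hs : 0 < s)
    (hc : Summable fun i => ‖c i * s ^ (-(p i + 1))‖) :
    ContinuousOn (fun y : ℝ => ∑' i, c i * (y ^ p i / Real.Gamma (p i + 1))) (Set.Ici 0) := by
  have hloc : ∀ R : ℝ, 0 ≤ R →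
      ContinuousOn (fun y : ℝ => ∑' i, c i * (y ^ p i / Real.Gamma (p i + 1))) (Set.Icc 0 R) := by
    intro R hR
    refine continuousOn_tsum (u := fun i => Real.exp (s * (R + 1)) * ‖c i * s ^ (-(p i + 1))‖)
      ?_ (hc.mul_left _) ?_
    · intro i
      exact (((Real.continuous_rpow_const (hp i)).div_const _).const_mul _).continuousOn
    · intro i y hy
      have hG : 0 < Real.Gamma (p i + 1) := Real.Gamma_pos_of_pos (by linarith [hp i])
      have hy0 := hy.1
      have h0 : 0 ≤ y ^ p i / Real.Gamma (p i + 1) := by positivity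
      have h1 : 0 ≤ s ^ (-(p i + 1)) := by positivity
      rw [norm_mul, norm_mul, Real.norm_of_nonneg h0, Real.norm_of_nonneg h1, mul_left_comm]
      refine mul_le_mul_of_nonneg_left ?_ (norm_nonneg _)
      refine le_trans ?_ (pow_bound (p i) s R (hp i) hs hR)
      gcongr
      · exact hp i
      · exact hy.2
  intro y hy
  have h := hloc (y + 1) (by have : (0 : ℝ) ≤ y := hy
                             linarith) y ⟨hy, by linarith⟩
  refine h.mono_of_mem_nhdsWithin ?_
  have : Set.Iic (y + 1) ∈ nhds y := Iic_mem_nhds (by linarith)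
  exact Filter.inter_mem self_mem_nhdsWithin (mem_nhdsWithin_of_mem_nhds this)

lemma lap_cdf {Ω : Type*} [MeasureSpace Ω] [IsProbabilityMeasure (ℙ : Measure Ω)]
    (Y : Ω → ℝ) (hY : Measurable Y) (hYnonneg : ∀ᵐ ω, 0 ≤ Y ω) (s : ℝ) (hs : 0 < s) :
    ∫ y in Set.Ioi 0, Real.exp (-s * y) * (ℙ {ω | Y ω ≤ y}).toReal
      = s⁻¹ * ∫ ω, Real.exp (-s * Y ω) := by
  set S : Set (ℝ × Ω) := {z | Y z.2 ≤ z.1} with hS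
  have hSm : MeasurableSet S := measurableSet_le (hY.comp measurable_snd) measurable_fst
  have he : IntegrableOn (fun y : ℝ => Real.exp (-s * y)) (Set.Ioi 0) :=
    integrableOn_exp_mul_Ioi (by linarith) 0
  have hprod : Integrable (Function.uncurry fun (y : ℝ) (ω : Ω) =>
      S.indicator (fun z => Real.exp (-s * z.1)) (y, ω))
      ((volume.restrict (Set.Ioi 0)).prod (ℙ : Measure Ω)) := by
    have := (Integrable.comp_fst (ν := (ℙ : Measure Ω)) he).indicator hSm
    exact this
  have hsw := integral_integral_swap hprod
  have hl : ∀ y : ℝ, ∫ ω, S.indicator (fun z => Real.exp (-s * z.1)) (y, ω)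
      = Real.exp (-s * y) * (ℙ {ω | Y ω ≤ y}).toReal := by
    intro y
    have hm : MeasurableSet {ω | Y ω ≤ y} := measurableSet_le hY measurable_const
    have : (fun ω => S.indicator (fun z => Real.exp (-s * z.1)) (y, ω))
        = {ω | Y ω ≤ y}.indicator (fun _ => Real.exp (-s * y)) := by
      ext ω
      simp [Set.indicator, hS]
    rw [this, integral_indicator_const _ hm, smul_eq_mul, mul_comm]
    rfl
  have hr : ∀ᵐ ω, ∫ y in Set.Ioi 0, S.indicator (fun z => Real.exp (-s * z.1)) (y, ω)
      = s⁻¹ * Real.exp (-s * Y ω) := by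
    filter_upwards [hYnonneg] with ω hω
    have : (fun y : ℝ => S.indicator (fun z => Real.exp (-s * z.1)) (y, ω))
        = (Set.Ici (Y ω)).indicator (fun y => Real.exp (-s * y)) := by
      ext y
      simp [Set.indicator, hS]
    rw [this, ← integral_Ici_eq_integral_Ioi, setIntegral_indicator measurableSet_Ici,
      Set.Ici_inter_Ici, sup_eq_right.2 hω, integral_Ici_eq_integral_Ioi,
      integral_exp_mul_Ioi (by linarith)]
    field_simp
  simp only [hl] at hsw
  rw [hsw, integral_congr_ae hr, integral_const_mul]

lemma gamma_asc (c : ℝ) (hc : 0 < c) (k : ℕ) :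
    Real.Gamma (c + k) = Real.Gamma c * (ascPochhammer ℝ k).eval c := by
  induction k with
  | zero => simp
  | succ k ih =>
    rw [ascPochhammer_succ_eval, Nat.cast_succ, ← add_assoc, Real.Gamma_add_one (by positivity), ih]
    ring

/-- coefficients of the series -/
noncomputable def coefC (N : ℕ) (α : ℝ) (lam : Fin N → ℝ) (m : Fin N → ℕ) : ℝ :=
  ∏ n, (ascPochhammer ℝ (m n)).eval α / (m n).factorial * (-(lam n)⁻¹) ^ m n

/-- exponents of the series -/
noncomputable def expP (N : ℕ) (α : ℝ) (m : Fin N → ℕ) : ℝ := N * α + ((∑ n, m n : ℕ) : ℝ)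

noncomputable def cdfF (N : ℕ) (α : ℝ) (lam : Fin N → ℝ) (y : ℝ) : ℝ :=
  ((∏ n, lam n) ^ α)⁻¹ *
    ∑' m, coefC N α lam m * (y ^ expP N α m / Real.Gamma (expP N α m + 1))

lemma cdfF_eq (N : ℕ) (hN : 0 < N) (α : ℝ) (hα : 0 < α) (lam : Fin N → ℝ) (y : ℝ) (hy : 0 ≤ y) :
    y ^ ((N : ℝ) * α) / ((∏ n, lam n) ^ α * Real.Gamma (1 + (N : ℝ) * α)) *
        lauricellaPhi2 N (fun _ => α) (1 + (N : ℝ) * α) (fun n => -y / lam n)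
      = cdfF N α lam y := by
  have hNa : 0 < (N : ℝ) * α := by positivity
  have hG := (Real.Gamma_pos_of_pos (show 0 < 1 + (N : ℝ) * α by positivity)).ne'
  unfold cdfF lauricellaPhi2
  rw [← tsum_mul_left, ← tsum_mul_left]
  congr 1
  ext m
  have h1 : y ^ expP N α m = y ^ ((N : ℝ) * α) * ∏ n, y ^ m n := by
    rw [expP, Real.rpow_add_of_nonneg hy hNa.le (by positivity), Real.rpow_natCast,
      Finset.prod_pow_eq_pow_sum]
  have h2 : Real.Gamma (expP N α m + 1) = Real.Gamma (1 + (N : ℝ) * α) *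
      (ascPochhammer ℝ (∑ n, m n)).eval (1 + (N : ℝ) * α) := by
    rw [← gamma_asc _ (by positivity), expP]
    congr 1
    ring
  have h3 : coefC N α lam m * ∏ n, y ^ m n
      = (∏ n, (ascPochhammer ℝ (m n)).eval α) *
        ∏ n, (-y / lam n) ^ m n / (Nat.factorial (m n)) := by
    rw [coefC, ← Finset.prod_mul_distrib, ← Finset.prod_mul_distrib]
    refine Finset.prod_congr rfl fun n _ => ?_
    rw [show -y / lam n = (-(lam n)⁻¹) * y by ring, mul_pow]
    ring
  rw [h1, h2, show coefC N α lam m * ((y ^ ((N : ℝ) * α) * ∏ n, y ^ m n) /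
      (Real.Gamma (1 + (N : ℝ) * α) * (ascPochhammer ℝ (∑ n, m n)).eval (1 + (N : ℝ) * α)))
      = (coefC N α lam m * ∏ n, y ^ m n) * (y ^ ((N : ℝ) * α) /
      (Real.Gamma (1 + (N : ℝ) * α) * (ascPochhammer ℝ (∑ n, m n)).eval (1 + (N : ℝ) * α))) by
      ring, h3]
  simp only [div_eq_mul_inv, mul_inv]
  ring

lemma coef_sum (N : ℕ) (α : ℝ) (lam : Fin N → ℝ)
    (hlam : ∀ n, 0 < lam n) (s : ℝ) (hs : 0 < s) (hls : ∀ n, 1 < lam n * s) :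
    (Summable fun m => ‖coefC N α lam m * s ^ (-(expP N α m + 1))‖) ∧
    ((∏ n, lam n) ^ α)⁻¹ * ∑' m, coefC N α lam m * s ^ (-(expP N α m + 1))
      = s⁻¹ * ∏ n, (1 + lam n * s) ^ (-α) := by
  have hx : ∀ n, |(lam n * s)⁻¹| < 1 := by
    intro n
    rw [abs_of_pos (by have := hlam n; positivity)]
    exact inv_lt_one_of_one_lt₀ (hls n)
  have hb := fun n => binom_hasSum α ((lam n * s)⁻¹) (hx n)
  obtain ⟨p1, p2⟩ := prod_hasSum N
    (fun n k => (ascPochhammer ℝ k).eval α / k.factorial * (-(lam n * s)⁻¹) ^ k)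
    (fun n => (hb n).1)
  have e : ∀ m : Fin N → ℕ, coefC N α lam m * s ^ (-(expP N α m + 1))
      = s ^ (-((N : ℝ) * α + 1)) *
        ∏ n, (ascPochhammer ℝ (m n)).eval α / (m n).factorial * (-(lam n * s)⁻¹) ^ m n := by
    intro m
    have : s ^ (-(expP N α m + 1)) = s ^ (-((N : ℝ) * α + 1)) * ∏ n, (s⁻¹) ^ m n := by
      rw [expP, show -(N * α + ((∑ n, m n : ℕ) : ℝ) + 1)
        = -((N : ℝ) * α + 1) + -((∑ n, m n : ℕ) : ℝ) by ring, Real.rpow_add hs,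
        Real.rpow_neg hs.le ((∑ n, m n : ℕ) : ℝ), Real.rpow_natCast, Finset.prod_pow_eq_pow_sum,
        inv_pow]
    rw [this, coefC, mul_left_comm, ← Finset.prod_mul_distrib]
    congr 1
    refine Finset.prod_congr rfl fun n _ => ?_
    rw [show -(lam n * s)⁻¹ = (-(lam n)⁻¹) * s⁻¹ by rw [mul_inv]; ring, mul_pow]
    ring
  simp only [e]
  constructor
  · simp only [norm_mul (s ^ (-((N : ℝ) * α + 1)))]
    exact p1.mul_left _
  · rw [tsum_mul_left, p2.tsum_eq]
    simp only [fun n => (hb n).2]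
    have e1 : s ^ (-((N : ℝ) * α + 1)) = s⁻¹ * ∏ n : Fin N, s ^ (-α) := by
      rw [Finset.prod_const, Finset.card_univ, Fintype.card_fin, ← Real.rpow_natCast,
        ← Real.rpow_mul hs.le, ← Real.rpow_neg_one s, ← Real.rpow_add hs]
      congr 1
      ring
    have e2 : ((∏ n, lam n) ^ α)⁻¹ = ∏ n, (lam n) ^ (-α) := by
      rw [← Real.rpow_neg (Finset.prod_nonneg fun n _ => (hlam n).le),
        Real.finsetProd_rpow _ _ (fun n _ => (hlam n).le)]
    rw [e1, e2, mul_assoc, mul_left_comm, ← Finset.prod_mul_distrib, ← Finset.prod_mul_distrib]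
    congr 1
    refine Finset.prod_congr rfl fun n _ => ?_
    have := hlam n
    rw [← Real.mul_rpow hs.le (by positivity), ← Real.mul_rpow this.le (by positivity)]
    congr 1
    field_simp
    ring

/-- If `Y ≥ 0` a.s. has Laplace transform `E[e^{−sY}] = ∏ (1 + λₙ s)^{−α}` for all `s > 0`,
then `P(Y ≤ y) = y^{Nα} / ((∏ λₙ)^α Γ(1 + Nα)) · Φ₂^(N)(α,…,α; 1+Nα; −y/λ₁,…,−y/λ_N)`
for every `y ≥ 0`. -/
theorem cdf_sum_correlated_gamma {Ω : Type*} [MeasureSpace Ω]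
    [IsProbabilityMeasure (ℙ : Measure Ω)]
    (N : ℕ) (hN : 0 < N) (α : ℝ) (hα : 0 < α)
    (lam : Fin N → ℝ) (hlam : ∀ n, 0 < lam n)
    (Y : Ω → ℝ) (hY : Measurable Y) (hYnonneg : ∀ᵐ ω, 0 ≤ Y ω)
    (hLaplace : ∀ s : ℝ, 0 < s →
      ∫ ω, Real.exp (-s * Y ω) = ∏ n, (1 + lam n * s) ^ (-α))
    (y : ℝ) (hy : 0 ≤ y) :
    (ℙ {ω | Y ω ≤ y}).toReal =
      y ^ ((N : ℝ) * α) / ((∏ n, lam n) ^ α * Real.Gamma (1 + (N : ℝ) * α)) *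
        lauricellaPhi2 N (fun _ => α) (1 + (N : ℝ) * α) (fun n => -y / lam n) := by
  rw [cdfF_eq N hN α hα lam y hy]
  set G : ℝ → ℝ := fun y => (ℙ {ω | Y ω ≤ y}).toReal with hG
  set s1 : ℝ := 1 + ∑ n, (lam n)⁻¹ with hs1
  have hsum : 0 ≤ ∑ n, (lam n)⁻¹ := Finset.sum_nonneg fun n _ => (inv_pos.2 (hlam n)).le
  have hs1p : 0 < s1 := by linarith
  have hbig : ∀ s, s1 ≤ s → ∀ n, 1 < lam n * s := by
    intro s hs n
    have h1 : (lam n)⁻¹ ≤ ∑ n, (lam n)⁻¹ :=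
      Finset.single_le_sum (f := fun n => (lam n)⁻¹) (fun n _ => (inv_pos.2 (hlam n)).le)
        (Finset.mem_univ n)
    have h2 : (lam n)⁻¹ < s := by linarith
    rwa [inv_lt_iff_one_lt_mul₀' (hlam n)] at h2
  have hexp : ∀ m, 0 ≤ expP N α m := fun m => by unfold expP; positivity
  have hpos : ∀ s, s1 ≤ s → s⁻¹ * ∏ n, (1 + lam n * s) ^ (-α) ≠ 0 := by
    intro s hs
    have hs0 : 0 < s := by linarith
    apply ne_of_gt
    refine mul_pos (inv_pos.2 hs0) (Finset.prod_pos fun n _ => ?_)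
    have := hlam n
    positivity
  have hFl : ∀ s, s1 ≤ s → ∫ y in Set.Ioi 0, Real.exp (-s * y) * cdfF N α lam y
      = s⁻¹ * ∏ n, (1 + lam n * s) ^ (-α) := by
    intro s hs
    have hs0 : 0 < s := by linarith
    obtain ⟨c1, c2⟩ := coef_sum N α lam hlam s hs0 (hbig s hs)
    rw [← c2, ← series_lap _ _ hexp s hs0 c1, ← integral_const_mul]
    congr 1
    ext x
    unfold cdfF
    ring
  have hGl : ∀ s, s1 ≤ s → ∫ y in Set.Ioi 0, Real.exp (-s * y) * G y
      = s⁻¹ * ∏ n, (1 + lam n * s) ^ (-α) := by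
    intro s hs
    have hs0 : 0 < s := by linarith
    rw [← hLaplace s hs0]
    exact lap_cdf Y hY hYnonneg s hs0
  have hFi : ∀ s, s1 ≤ s →
      IntegrableOn (fun y => Real.exp (-s * y) * cdfF N α lam y) (Set.Ioi 0) := by
    intro s hs
    by_contra hcon
    exact hpos s hs ((hFl s hs).symm.trans (integral_undef hcon))
  have hGi : ∀ s, s1 ≤ s →
      IntegrableOn (fun y => Real.exp (-s * y) * G y) (Set.Ioi 0) := by
    intro s hs
    by_contra hcon
    exact hpos s hs ((hGl s hs).symm.trans (integral_undef hcon))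
  have hae := laplace_unique
    (fun y => Real.exp (-s1 * y) * cdfF N α lam y - Real.exp (-s1 * y) * G y)
    ((hFi s1 le_rfl).sub (hGi s1 le_rfl)) (by
      intro k
      have hk : s1 ≤ s1 + k := by
        have : (0 : ℝ) ≤ k := Nat.cast_nonneg k
        linarith
      have : (fun y => Real.exp (-(k : ℝ) * y) *
          (Real.exp (-s1 * y) * cdfF N α lam y - Real.exp (-s1 * y) * G y))
          = fun y => Real.exp (-(s1 + k) * y) * cdfF N α lam y - Real.exp (-(s1 + k) * y) * G y := by
        ext x
        rw [show -(s1 + k) * x = -(k : ℝ) * x + -s1 * x by ring, Real.exp_add]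
        ring
      rw [this, integral_sub (hFi _ hk) (hGi _ hk), hFl _ hk, hGl _ hk, sub_self])
  have hae' : ∀ᵐ x ∂(volume.restrict (Set.Ioi (0 : ℝ))), cdfF N α lam x = G x := by
    filter_upwards [hae] with x hx
    have hx' : Real.exp (-s1 * x) * (cdfF N α lam x - G x) = 0 := by
      rw [mul_sub]; exact hx
    rcases mul_eq_zero.1 hx' with h | h
    · exact absurd h (Real.exp_pos _).ne'
    · linarith
  -- right continuity
  have hFc : ContinuousWithinAt (cdfF N α lam) (Set.Ioi y) y := by
    have h := series_cont _ _ hexp s1 hs1p (coef_sum N α lam hlam s1 hs1p (hbig s1 le_rfl)).1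
    have h2 := (h.const_mul (((∏ n, lam n) ^ α)⁻¹)) y hy
    exact h2.mono fun x hx => hy.trans (le_of_lt hx)
  have hGc : ContinuousWithinAt G (Set.Ioi y) y := by
    have : IsProbabilityMeasure ((ℙ : Measure Ω).map Y) :=
      Measure.isProbabilityMeasure_map hY.aemeasurable
    have hGe : G = ProbabilityTheory.cdf ((ℙ : Measure Ω).map Y) := by
      ext x
      rw [ProbabilityTheory.cdf_eq_real, Measure.real, Measure.map_apply hY measurableSet_Iic]
      rfl
    rw [hGe]
    exact ((ProbabilityTheory.cdf ((ℙ : Measure Ω).map Y)).right_continuous y).mono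
      Set.Ioi_subset_Ici_self
  by_contra hne
  have hd : Filter.Tendsto (fun x => G x - cdfF N α lam x) (nhdsWithin y (Set.Ioi y))
      (nhds (G y - cdfF N α lam y)) := hGc.sub hFc
  have hev := hd.eventually_ne (sub_ne_zero.2 hne)
  obtain ⟨u, hu, hsub⟩ := mem_nhdsGT_iff_exists_Ioo_subset.1 hev
  rw [ae_restrict_iff' measurableSet_Ioi] at hae'
  have hz : volume (Set.Ioo y u) = 0 := by
    refine measure_mono_null ?_ (ae_iff.1 hae')
    intro x hx hcon
    exact hsub hx (by rw [hcon (lt_of_le_of_lt hy hx.1), sub_self])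
  rw [Real.volume_Ioo, ENNReal.ofReal_eq_zero] at hz
  have : y < u := hu
  linarith
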